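/- Let A ∈ ℝ^{n×n}, B ∈ ℝ^{n×m}, Y ∈ ℝ^{m×n}, let X ∈ ℝ^{n×n} be symmetric positive definite, let Z ∈ ℝ^{m×m} be diagonal positive definite, let ε > 0, and let 0 < a ≤ b. Suppose that for both λ = a and λ = b the symmetric block matrix [[sym(AX + λBΔ₂Y) + εX, BZ + (1/2)λYᵀ(Δ₁−Δ₂)], [(BZ + (1/2)λYᵀ(Δ₁−Δ₂))ᵀ, −Z]] is negative semidefinite. Then for every λ ∈ [a, b], sym(AX + λBΔ₂Y) + εX + (BZ + (1/2)λYᵀ(Δ₁−Δ₂))·Z⁻¹·(BZ + (1/2)λYᵀ(Δ₁−Δ₂))ᵀ is negative semidefinite. -/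

import Mathlib

open Matrix

/-- `sym(M) := M + Mᵀ`. -/
def symMat {d : ℕ} (M : Matrix (Fin d) (Fin d) ℝ) : Matrix (Fin d) (Fin d) ℝ := M + Mᵀ

/-- A real symmetric matrix `M` is negative semidefinite if `vᵀMv ≤ 0` for all real `v`. -/
def NegSemidef {d : Type*} [Fintype d] (M : Matrix d d ℝ) : Prop :=
  ∀ v : d → ℝ, v ⬝ᵥ M *ᵥ v ≤ 0

theorem schur_aux {n m : ℕ} (P : Matrix (Fin n) (Fin n) ℝ) (G : Matrix (Fin n) (Fin m) ℝ)
    (Z : Matrix (Fin m) (Fin m) ℝ) (hZ : IsUnit Z.det)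
    (h : NegSemidef (Matrix.fromBlocks P G Gᵀ (-Z))) : NegSemidef (P + G * Z⁻¹ * Gᵀ) := by
  intro v
  have h1 := h (Sum.elim v (Z⁻¹ *ᵥ (Gᵀ *ᵥ v)))
  rw [Matrix.fromBlocks_mulVec] at h1
  simp only [Sum.elim_comp_inl, Sum.elim_comp_inr, sumElim_dotProduct_sumElim,
    Matrix.mulVec_mulVec, Matrix.neg_mul, Matrix.neg_mulVec] at h1
  rw [← Matrix.mul_assoc Z, Matrix.mul_nonsing_inv _ hZ, Matrix.one_mul, add_neg_cancel,
    dotProduct_zero, add_zero, ← Matrix.mul_assoc, ← Matrix.add_mulVec] at h1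
  exact h1

/-- if for both `λ = a` and `λ = b` the block matrix
`[[sym(AX + λBΔ₂Y) + εX, BZ + (1/2)λYᵀ(Δ₁−Δ₂)], [∙ᵀ, −Z]]` is negative semidefinite,
then for every `λ ∈ [a,b]`,
`sym(AX + λBΔ₂Y) + εX + (BZ + (1/2)λYᵀ(Δ₁−Δ₂))·Z⁻¹·(BZ + (1/2)λYᵀ(Δ₁−Δ₂))ᵀ`
is negative semidefinite. -/
theorem stmt14 (n m : ℕ)
    (A : Matrix (Fin n) (Fin n) ℝ) (B : Matrix (Fin n) (Fin m) ℝ)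
    (Y : Matrix (Fin m) (Fin n) ℝ)
    (X : Matrix (Fin n) (Fin n) ℝ) (hX : X.PosDef)
    (δ1 δ2 ζ : Fin m → ℝ)
    (Δ₁ Δ₂ Z : Matrix (Fin m) (Fin m) ℝ)
    (hΔ₁ : Δ₁ = Matrix.diagonal δ1) (hΔ₂ : Δ₂ = Matrix.diagonal δ2)
    (hZ : Z = Matrix.diagonal ζ) (hζ : ∀ k, 0 < ζ k)
    (ε : ℝ) (hε : 0 < ε)
    (a b : ℝ) (ha : 0 < a) (hab : a ≤ b)
    (hLMI : ∀ lam : ℝ, lam = a ∨ lam = b →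
      NegSemidef (Matrix.fromBlocks
        (symMat (A * X + lam • (B * Δ₂ * Y)) + ε • X)
        (B * Z + ((1 / 2) * lam) • (Yᵀ * (Δ₁ - Δ₂)))
        (B * Z + ((1 / 2) * lam) • (Yᵀ * (Δ₁ - Δ₂)))ᵀ
        (-Z))) :
    ∀ lam : ℝ, lam ∈ Set.Icc a b →
      NegSemidef (symMat (A * X + lam • (B * Δ₂ * Y)) + ε • X
        + (B * Z + ((1 / 2) * lam) • (Yᵀ * (Δ₁ - Δ₂))) * Z⁻¹
          * (B * Z + ((1 / 2) * lam) • (Yᵀ * (Δ₁ - Δ₂)))ᵀ) := by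
  intro lam hlam
  apply schur_aux
  · rw [hZ, Matrix.det_diagonal]
    exact (Finset.prod_pos fun k _ => hζ k).ne'.isUnit
  obtain ⟨s, t, hs, ht, hst, hl⟩ : ∃ s t : ℝ, 0 ≤ s ∧ 0 ≤ t ∧ s + t = 1 ∧ s * a + t * b = lam := by
    rw [← segment_eq_Icc hab] at hlam
    obtain ⟨s, t, hs, ht, hst, hl⟩ := hlam
    exact ⟨s, t, hs, ht, hst, by simpa using hl⟩
  have hA := hLMI a (Or.inl rfl)
  have hB := hLMI b (Or.inr rfl)
  intro v
  have e : ∀ M Ma Mb : Matrix (Fin n ⊕ Fin m) (Fin n ⊕ Fin m) ℝ, M = s • Ma + t • Mb →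
      NegSemidef Ma → NegSemidef Mb → v ⬝ᵥ M *ᵥ v ≤ 0 := by
    intro M Ma Mb hM h1 h2
    have h1 := mul_nonneg hs (neg_nonneg.2 (h1 v))
    have h2 := mul_nonneg ht (neg_nonneg.2 (h2 v))
    rw [hM, Matrix.add_mulVec, Matrix.smul_mulVec, Matrix.smul_mulVec, dotProduct_add,
      dotProduct_smul, dotProduct_smul, smul_eq_mul, smul_eq_mul]
    linarith
  refine e _ _ _ ?_ hA hB
  obtain rfl : s = 1 - t := by linarith
  subst hl
  rw [Matrix.fromBlocks_smul, Matrix.fromBlocks_smul, Matrix.fromBlocks_add]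
  congr 1
  · ext i j
    simp only [symMat, Matrix.add_apply, Matrix.smul_apply, Matrix.transpose_apply, smul_eq_mul]
    ring
  · ext i j
    simp only [Matrix.add_apply, Matrix.smul_apply, smul_eq_mul]
    ring
  · ext i j
    simp only [Matrix.add_apply, Matrix.smul_apply, Matrix.transpose_apply, smul_eq_mul]
    ring
  · ext i j
    simp only [Matrix.add_apply, Matrix.smul_apply, Matrix.neg_apply, smul_eq_mul]
    ring
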